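/- Let G be a simple graph with vertex set V. Then the map sending a semi-smooth travel groupoid (V,*) on G to its right translation system is a bijection between the set of all semi-smooth travel groupoids on G and the set of all semi-smooth T-partition systems on G. -/

import Mathlib

variable {V : Type*}

/-- The right translation system of a groupoid `(V, op)`:
`rts op u v = {w ∈ V | u * w = v}`. -/
def rts (op : V → V → V) (u v : V) : Set V := {w | op u w = v}

/-- Axiom (t1): `(u * v) * u = u` for all `u, v`. -/
def T1 (op : V → V → V) : Prop := ∀ u v : V, op (op u v) u = u

/-- Axiom (t2): if `(u * v) * v = u` then `u = v`. -/
def T2 (op : V → V → V) : Prop := ∀ u v : V, op (op u v) v = u → u = v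

/-- A travel groupoid: a groupoid satisfying (t1) and (t2). -/
def IsTravelGroupoid (op : V → V → V) : Prop := T1 op ∧ T2 op

/-- Axiom (t3) (simple): if `v * u ≠ u` then `u * (v * u) = u * v`. -/
def T3 (op : V → V → V) : Prop := ∀ u v : V, op v u ≠ u → op u (op v u) = op u v

/-- Axiom (t4) (smooth): if `u * v = u * w` then `u * (v * w) = u * v`. -/
def T4 (op : V → V → V) : Prop := ∀ u v w : V, op u v = op u w → op u (op v w) = op u v

/-- Axiom (t5) (semi-smooth): if `u * v = u * w` then
`u * (v * w) = u * v` or `u * ((v * w) * w) = u * v`. -/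
def T5 (op : V → V → V) : Prop :=
  ∀ u v w : V, op u v = op u w →
    op u (op v w) = op u v ∨ op u (op (op v w) w) = op u v

/-- A travel groupoid `(V, op)` is on the graph `G` if the edges of `G` are exactly
the pairs `{u, v}` with `u ≠ v` and `u * v = v`. -/
def IsOnGraph (op : V → V → V) (G : SimpleGraph V) : Prop :=
  ∀ u v : V, G.Adj u v ↔ u ≠ v ∧ op u v = v

/-- The closed neighborhood `N_G[u]` of a vertex `u` in a graph `G`. -/
def closedNbhd (G : SimpleGraph V) (u : V) : Set V := insert u (G.neighborSet u)

/-- A T-partition system on a graph `G`: a family `P u v ⊆ V` indexed by pairs of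
vertices satisfying (P0) (stated as: the sets `P u v` for `v ∈ N_G[u]` cover `V`
and are pairwise disjoint), (P1a), (P1b), (P1c), and (P2). -/
structure IsTPartitionSystem (G : SimpleGraph V) (P : V → V → Set V) : Prop where
  cover : ∀ u a : V, ∃ v ∈ closedNbhd G u, a ∈ P u v
  pairwise_disjoint : ∀ u : V, ∀ v ∈ closedNbhd G u, ∀ w ∈ closedNbhd G u,
    v ≠ w → P u v ∩ P u w = ∅
  p1a : ∀ u : V, P u u = {u}
  p1b : ∀ u v : V, u ≠ v → (v ∈ P u v ↔ G.Adj u v)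
  p1c : ∀ u v : V, u ≠ v → (P u v = ∅ ↔ ¬ G.Adj u v)
  p2 : ∀ u v : V, u ≠ v → P u v ∩ P v u = ∅

/-- Property (R3) (simple T-partition system). -/
def R3 (P : V → V → Set V) : Prop :=
  ∀ u v x y : V, u ∈ P v x → v ∈ P u y → u ≠ x → v ≠ y → x ∈ P u y ∧ y ∈ P v x

/-- Property (R4) (smooth T-partition system). -/
def R4 (P : V → V → Set V) : Prop :=
  ∀ u v x y z : V, x ∈ P u v → y ∈ P u v → y ∈ P x z → z ∈ P u v

/-- Property (R5) (semi-smooth T-partition system). -/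
def R5 (P : V → V → Set V) : Prop :=
  ∀ u v x y z w : V, x ∈ P u v → y ∈ P u v → y ∈ P x z ∩ P z w →
    z ∈ P u v ∨ w ∈ P u v
namespace IsTravelGroupoid

variable {op : V → V → V}

theorem op_self (h : IsTravelGroupoid op) (u : V) : op u u = u :=
  h.2 (op u u) u (by rw [h.1])

theorem eq_of_op_eq_left (h : IsTravelGroupoid op) {u v : V} (huv : op u v = u) : u = v :=
  h.2 u v (by rw [huv, huv])

theorem op_op_self (h : IsTravelGroupoid op) (u v : V) : op u (op u v) = op u v := by
  simpa only [h.1 u v] using h.1 (op u v) u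

theorem isTPartitionSystem_rts (h : IsTravelGroupoid op) {G : SimpleGraph V}
    (hG : IsOnGraph op G) : IsTPartitionSystem G (rts op) where
  cover u a := by
    refine ⟨op u a, ?_, rfl⟩
    by_cases hu : op u a = u
    · exact Or.inl hu
    · exact Or.inr ((hG u (op u a)).2 ⟨Ne.symm hu, h.op_op_self u a⟩)
  pairwise_disjoint u v _ w _ hvw :=
    Set.eq_empty_of_forall_notMem fun _ ha => hvw (ha.1.symm.trans ha.2)
  p1a u := by
    ext a
    constructor
    · exact fun ha => (h.eq_of_op_eq_left ha).symm
    · rintro rfl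
      exact h.op_self a
  p1b u v huv := ⟨fun hv => (hG u v).2 ⟨huv, hv⟩, fun hv => ((hG u v).1 hv).2⟩
  p1c u v huv := by
    rw [Set.eq_empty_iff_forall_notMem]
    refine ⟨fun he ha => he v ((hG u v).1 ha).2, ?_⟩
    rintro hn a rfl
    exact hn ((hG u (op u a)).2 ⟨huv, h.op_op_self u a⟩)
  p2 u v huv := by
    refine Set.eq_empty_of_forall_notMem fun a ha => huv ?_
    have hu : op u a = v := ha.1
    have hv : op v a = u := ha.2
    obtain rfl : u = a := h.2 u a (by rw [hu, hv])
    rw [← hu, h.op_self]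

end IsTravelGroupoid

theorem r5_rts_iff_t5 (op : V → V → V) : R5 (rts op) ↔ T5 op := by
  constructor
  · exact fun h u v w huv => h u (op u v) v w _ _ rfl huv.symm ⟨rfl, rfl⟩
  · rintro h u _ x y _ _ rfl hy ⟨rfl, rfl⟩
    exact h u x y (Eq.symm hy)

theorem rts_injective : Function.Injective (rts : (V → V → V) → V → V → Set V) := by
  intro op op' h
  funext u w
  have hw : w ∈ rts op u (op u w) := rfl
  rw [h] at hw
  exact Eq.symm hw

namespace IsTPartitionSystem

variable {G : SimpleGraph V} {P : V → V → Set V}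

theorem mem_closedNbhd (h : IsTPartitionSystem G P) {u v a : V} (ha : a ∈ P u v) :
    v ∈ closedNbhd G u := by
  by_cases huv : u = v
  · exact Or.inl huv.symm
  · refine Or.inr (by_contra fun hn => ?_)
    rw [(h.p1c u v huv).2 hn] at ha
    exact ha

theorem exists_rts_eq (h : IsTPartitionSystem G P) : ∃ op : V → V → V, rts op = P := by
  choose op hmem hop using h.cover
  refine ⟨op, ?_⟩
  funext u v
  ext a
  constructor
  · rintro rfl
    exact hop u a
  · intro ha
    by_contra hne
    have he := h.pairwise_disjoint u _ (hmem u a) v (h.mem_closedNbhd ha) hne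
    exact Set.eq_empty_iff_forall_notMem.1 he a ⟨hop u a, ha⟩

variable {op : V → V → V}

theorem op_self (h : IsTPartitionSystem G (rts op)) (u : V) : op u u = u := by
  have hu : u ∈ rts op u u := by
    rw [h.p1a]
    rfl
  exact hu

theorem isOnGraph (h : IsTPartitionSystem G (rts op)) : IsOnGraph op G := fun u v =>
  ⟨fun ha => ⟨ha.ne, (h.p1b u v ha.ne).2 ha⟩, fun hv => (h.p1b u v hv.1).1 hv.2⟩

theorem isTravelGroupoid (h : IsTPartitionSystem G (rts op)) : IsTravelGroupoid op := by
  constructor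
  · intro u v
    have hv : v ∈ rts op u (op u v) := rfl
    rcases h.mem_closedNbhd hv with he | ha
    · rw [he, h.op_self]
    · exact ((h.isOnGraph _ _).1 ha.symm).2
  · intro u v huv
    by_cases hu : u = op u v
    · have hv : v ∈ rts op u u := hu.symm
      rw [h.p1a] at hv
      exact Eq.symm hv
    · exact (Set.eq_empty_iff_forall_notMem.1 (h.p2 u _ hu) v ⟨rfl, huv⟩).elim

end IsTPartitionSystem

theorem stmt17 [Nonempty V] (G : SimpleGraph V) :
    Set.BijOn (fun op : V → V → V => rts op)
      {op : V → V → V | (IsTravelGroupoid op ∧ T5 op) ∧ IsOnGraph op G}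
      {P : V → V → Set V | IsTPartitionSystem G P ∧ R5 P} := by
  refine ⟨?_, rts_injective.injOn, ?_⟩
  · rintro op ⟨⟨h, h5⟩, hG⟩
    exact ⟨h.isTPartitionSystem_rts hG, (r5_rts_iff_t5 op).2 h5⟩
  · rintro P ⟨h, h5⟩
    obtain ⟨op, rfl⟩ := h.exists_rts_eq
    exact ⟨op, ⟨⟨h.isTravelGroupoid, (r5_rts_iff_t5 op).1 h5⟩, h.isOnGraph⟩, rfl⟩
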